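/- Variational source inequality (case s = 2, q = ∞): let γ† : S¹ → ℝ be a nonnegative C² function and let γ : S¹ → ℝ be a nonnegative C¹ function. Then ∫_{S¹} (γ'(t) − γ†'(t))² dμ(t) ≤ ∫_{S¹} γ'(t)² dμ(t) − ∫_{S¹} γ†'(t)² dμ(t) + 2·(sup_{t∈S¹} |γ†''(t)|)·‖F(γ) − F(γ†)‖²_{L²(S¹×[0,∞))}. -/

import Mathlib

open MeasureTheory Real Set Filter Topology

noncomputable section

instance : Fact (0 < 2 * π) := ⟨by positivity⟩

/-- The circle `ℝ / 2πℤ`. -/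
abbrev S1 : Type := AddCircle (2 * π)

/-- The Haar measure of total mass `2π` on the circle. -/
abbrev μ : Measure S1 := volume

/-- The product of `μ` with Lebesgue measure restricted to `[0, ∞)`,
modelling the measure on `S¹ × [0, ∞)`. -/
abbrev ν : Measure (S1 × ℝ) := μ.prod (volume.restrict (Ici (0:ℝ)))

/-- The characteristic function of the hypograph of `γ`:
`F γ (t, x) = 1` if `x ≤ γ t` and `0` otherwise. -/
def F (γ : S1 → ℝ) : S1 × ℝ → ℝ := fun p => if p.2 ≤ γ p.1 then 1 else 0

/-- `γ : S¹ → ℝ` is `C¹` with derivative `dγ` if the corresponding `2π`-periodic function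
on `ℝ` is everywhere differentiable with derivative the periodic function corresponding
to `dγ`, and `dγ` is continuous. -/
def IsC1 (γ dγ : S1 → ℝ) : Prop :=
  Continuous dγ ∧ ∀ t : ℝ, HasDerivAt (fun x : ℝ => γ (x : S1)) (dγ (t : S1)) t

theorem IsC1.cont {γ dγ : S1 → ℝ} (h : IsC1 γ dγ) : Continuous γ := by
  refine (QuotientAddGroup.isQuotientMap_mk (AddSubgroup.zmultiples (2 * π))).continuous_iff.2 ?_
  exact continuous_iff_continuousAt.2 fun t => (h.2 t).continuousAt

theorem intble {f : S1 → ℝ} (h : Continuous f) : Integrable f μ :=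
  h.integrable_of_hasCompactSupport (HasCompactSupport.of_compactSpace f)

theorem parts {u u' v v' : S1 → ℝ} (hu : IsC1 u u') (hv : IsC1 v v') :
    ∫ t, u' t * v t + u t * v' t ∂μ = 0 := by
  have hc : Continuous (fun x : ℝ => (x : S1)) := AddCircle.continuous_mk' _
  rw [← AddCircle.intervalIntegral_preimage (2 * π) 0]
  rw [intervalIntegral.integral_deriv_mul_eq_sub (u := fun x : ℝ => u x) (v := fun x : ℝ => v x)
    (u' := fun x : ℝ => u' x) (v' := fun x : ℝ => v' x)
    (fun x _ => hu.2 x) (fun x _ => hv.2 x) ((hu.1.comp hc).intervalIntegrable _ _)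
    ((hv.1.comp hc).intervalIntegrable _ _)]
  have : ((0 + 2 * π : ℝ) : S1) = ((0:ℝ) : S1) := by
    rw [zero_add, AddCircle.coe_period]; rfl
  rw [this]; ring

theorem Fnorm {g h : S1 → ℝ} (hg : Continuous g) (hh : Continuous h)
    (hg0 : ∀ t, 0 ≤ g t) (hh0 : ∀ t, 0 ≤ h t) :
    (eLpNorm (fun p => F g p - F h p) 2 ν).toReal ^ 2 = ∫ t, |h t - g t| ∂μ := by
  have hmF : ∀ k : S1 → ℝ, Continuous k → Measurable (F k) := fun k hk =>
    Measurable.ite (measurableSet_le measurable_snd (hk.measurable.comp measurable_fst))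
      measurable_const measurable_const
  have hm := (hmF g hg).sub (hmF h hh)
  have e : eLpNorm (fun p => F g p - F h p) 2 ν ^ 2
      = ∫⁻ p, ‖F g p - F h p‖ₑ ^ 2 ∂ν := by
    have := eLpNorm_nnreal_pow_eq_lintegral (f := fun p => F g p - F h p) (μ := ν)
      (p := 2) (by norm_num)
    simpa using this
  rw [← ENNReal.toReal_pow, e, lintegral_prod _ (by
    exact (hm.enorm.pow_const 2).aemeasurable)]
  have inner : ∀ t, ∫⁻ x, ‖F g (t, x) - F h (t, x)‖ₑ ^ 2 ∂(volume.restrict (Ici (0:ℝ)))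
      = ENNReal.ofReal |h t - g t| := by
    intro t
    have : (fun x => ‖F g (t, x) - F h (t, x)‖ₑ ^ 2) = (uIoc (g t) (h t)).indicator 1 := by
      funext x
      by_cases h1 : x ≤ g t <;> by_cases h2 : x ≤ h t <;>
        simp [F, h1, h2, Set.indicator, mem_uIoc, not_le.1]
    rw [this, lintegral_indicator_one measurableSet_uIoc,
      Measure.restrict_apply measurableSet_uIoc, inter_eq_left.2, Real.volume_uIoc]
    intro x hx
    rw [mem_uIoc] at hx
    rw [mem_Ici]
    rcases hx with hx | hx
    · linarith [hg0 t]
    · linarith [hh0 t]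
  simp_rw [inner]
  rw [← ofReal_integral_eq_lintegral_ofReal (intble (by fun_prop))
    (Eventually.of_forall fun _ => abs_nonneg _), ENNReal.toReal_ofReal]
  exact integral_nonneg fun _ => abs_nonneg _

/-- Variational source inequality in the case `s = 2`, `q = ∞`: for `γ†` nonnegative of
class `C²` (with derivatives `d1`, `d2`) and `γ` nonnegative of class `C¹` (with
derivative `dγ`),
`∫ (γ' - γ†')² ≤ ∫ γ'² - ∫ γ†'² + 2 (sup |γ†''|) ‖F γ - F γ†‖²_{L²}`. -/
theorem variational_source_inequality (γdag d1 d2 γ dγ : S1 → ℝ)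
    (h1 : IsC1 γdag d1) (h2 : IsC1 d1 d2) (hdag0 : ∀ t, 0 ≤ γdag t)
    (hγ : IsC1 γ dγ) (hγ0 : ∀ t, 0 ≤ γ t) :
    ∫ t, (dγ t - d1 t) ^ 2 ∂μ
      ≤ ∫ t, dγ t ^ 2 ∂μ - ∫ t, d1 t ^ 2 ∂μ
        + 2 * (⨆ t : S1, |d2 t|)
          * (eLpNorm (fun p => F γ p - F γdag p) 2 ν).toReal ^ 2 := by
  have cγ := hγ.cont
  have cd := h1.cont
  have c1 := h1.1
  have c2 := h2.1
  have c3 := hγ.1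
  rw [Fnorm cγ cd hγ0 hdag0]
  have P1 := parts hγ h2
  have P2 := parts h1 h2
  have hbd : BddAbove (range fun t : S1 => |d2 t|) :=
    (isCompact_range c2.abs).bddAbove
  rw [← integral_const_mul, ← integral_sub (intble (by fun_prop)) (intble (by fun_prop)),
    ← integral_add (intble (by fun_prop)) (intble (by fun_prop))]
  have key : ∫ t, (dγ t - d1 t) ^ 2 ∂μ = ∫ t, ((dγ t ^ 2 - d1 t ^ 2)
      + (2 * (γ t - γdag t) * d2 t)) - 2 * (dγ t * d1 t + γ t * d2 t)
      + 2 * (d1 t * d1 t + γdag t * d2 t) ∂μ := by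
    congr 1; funext t; ring
  rw [key, integral_add (intble (by fun_prop)) (intble (by fun_prop)),
    integral_sub (intble (by fun_prop)) (intble (by fun_prop)),
    integral_const_mul, integral_const_mul, P1, P2]
  simp only [mul_zero, sub_zero, add_zero]
  refine integral_mono (intble (by fun_prop)) (intble (by fun_prop)) fun t => ?_
  have hM : |d2 t| ≤ ⨆ t : S1, |d2 t| := le_ciSup hbd t
  have : (γ t - γdag t) * d2 t ≤ (⨆ t : S1, |d2 t|) * |γdag t - γ t| := by
    refine (le_abs_self _).trans ?_
    rw [abs_mul, abs_sub_comm, mul_comm]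
    exact mul_le_mul_of_nonneg_right hM (abs_nonneg _)
  simp only
  linarith
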